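/- For the symmetric bilinear map Θ = Θ_{A,B,C,D,E} on ℂ³ and its curvature R, the following component formulas hold: R(e₃,e₁)e₁ = (C²/4)·e₃ − (CE/4)·e₁; R(e₃,e₂)e₂ = (D²/4)·e₃ − (DE/4)·e₂; R(e₁,e₂)e₁ = (CD/4)·e₁ + ((D²−2CD)/4)·e₂; R(e₁,e₂)e₂ = −((C²−2CD)/4)·e₁ − (CD/4)·e₂. -/

import Mathlib

noncomputable section

/-- `ℂ³`. -/
abbrev V3 : Type := Fin 3 → ℂ

/-- The standard basis of `ℂ³`: `e 0 = e₁ = ∂/∂z₁`, `e 1 = e₂ = ∂/∂z₂`, `e 2 = e₃ = ∂/∂τ`. -/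
def e (i : Fin 3) : V3 := Pi.single i 1

/-- The curvature tensor `R(X,Y)Z = Θ(X,Θ(Y,Z)) − Θ(Y,Θ(X,Z))`. -/
def curv (Θ : V3 →ₗ[ℂ] V3 →ₗ[ℂ] V3) (X Y Z : V3) : V3 :=
  Θ X (Θ Y Z) - Θ Y (Θ X Z)

/-- `TrR(X,Y) = tr (Z ↦ R(X,Y)Z)`. -/
def trR (Θ : V3 →ₗ[ℂ] V3 →ₗ[ℂ] V3) (X Y : V3) : ℂ :=
  LinearMap.trace ℂ V3 ((Θ X) ∘ₗ (Θ Y) - (Θ Y) ∘ₗ (Θ X))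

/-- `Ricci(Y,Z) = tr (X ↦ R(X,Y)Z)`. -/
def ricci (Θ : V3 →ₗ[ℂ] V3 →ₗ[ℂ] V3) (Y Z : V3) : ℂ :=
  LinearMap.trace ℂ V3 (Θ.flip (Θ Y Z) - (Θ Y) ∘ₗ (Θ.flip Z))

/-- The projective Weyl tensor in dimension three. -/
def weyl (Θ : V3 →ₗ[ℂ] V3 →ₗ[ℂ] V3) (X Y Z : V3) : V3 :=
  curv Θ X Y Z - ((1/4 : ℂ) * trR Θ X Y) • Z
    - (1/2 : ℂ) • (ricci Θ Y Z • X - ricci Θ X Z • Y)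
    - (1/8 : ℂ) • (trR Θ Y Z • X - trR Θ X Z • Y)

/-- Component formulas for the curvature of `Θ_{A,B,C,D,E}` on `ℂ³`
(`e₁ = e 0`, `e₂ = e 1`, `e₃ = e 2`). -/
theorem stmt_4 (A B C D E : ℂ)
    (Θ : V3 →ₗ[ℂ] V3 →ₗ[ℂ] V3)
    (hsymm : ∀ x y : V3, Θ x y = Θ y x)
    (h11 : Θ (e 0) (e 0) = C • e 0)
    (h22 : Θ (e 1) (e 1) = D • e 1)
    (h33 : Θ (e 2) (e 2) = A • e 0 + B • e 1 + E • e 2)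
    (h12 : Θ (e 0) (e 1) = (C/2) • e 0 + (D/2) • e 1)
    (h13 : Θ (e 0) (e 2) = (E/2) • e 0 + (C/2) • e 2)
    (h23 : Θ (e 1) (e 2) = (E/2) • e 1 + (D/2) • e 2)
    :
    curv Θ (e 2) (e 0) (e 0) = (C^2/4) • e 2 - (C*E/4) • e 0 ∧
    curv Θ (e 2) (e 1) (e 1) = (D^2/4) • e 2 - (D*E/4) • e 1 ∧
    curv Θ (e 0) (e 1) (e 0) = (C*D/4) • e 0 + ((D^2 - 2*C*D)/4) • e 1 ∧
    curv Θ (e 0) (e 1) (e 1) = -((C^2 - 2*C*D)/4) • e 0 - (C*D/4) • e 1 := by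
  have h21 := (hsymm (e 1) (e 0)).trans h12
  have h31 := (hsymm (e 2) (e 0)).trans h13
  have h32 := (hsymm (e 2) (e 1)).trans h23
  refine ⟨?_, ?_, ?_, ?_⟩ <;>
    simp only [curv, map_add, map_smul, h11, h22, h12, h13, h23, h21, h31, h32] <;>
    module
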